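/- Let 0 ≤ β < 1 and h ≥ 0. Then the overlap constant q = q_{β,h} and the quantity q₁ = q₁(β,h) satisfy: h²/(1−β²) − 2h⁴/(1−β²)³ ≤ q ≤ h²/(1−β²), and h − h²/(3(1−β²)) ≤ q₁ ≤ h. -/

import Mathlib

open MeasureTheory ProbabilityTheory

noncomputable section

/-- Standard Gaussian measure on `ℝ`. -/
def stdGaussian : Measure ℝ := gaussianReal 0 1

/-- The overlap constant `q_{β,h}`, the unique solution in `(0,1]` of the replica-symmetric
fixed point equation (set to `0` for `h = 0`). -/
def qOverlap (β h : ℝ) : ℝ :=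
  if h = 0 then 0 else
    sSup {q : ℝ | q ∈ Set.Ioc (0 : ℝ) 1 ∧
      q = ∫ g, Real.tanh (β * g * Real.sqrt q + h) ^ 2 ∂stdGaussian}

/-- `q₁(β,h) = E tanh(β g √q_{β,h} + h)`. -/
def q1 (β h : ℝ) : ℝ :=
  ∫ g, Real.tanh (β * g * Real.sqrt (qOverlap β h) + h) ∂stdGaussian

/-- Hyperbolic secant. -/
def sech (x : ℝ) : ℝ := 1 / Real.cosh x

/-- The Almeida–Thouless condition for `(β,h)`. -/
def ATCond (β h : ℝ) : Prop :=
  β ^ 2 * ∫ g, sech (β * g * Real.sqrt (qOverlap β h) + h) ^ 4 ∂stdGaussian < 1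

/-- The AT condition with gap at least `g0`. -/
def ATgap (β h g0 : ℝ) : Prop :=
  β ^ 2 * ∫ g, sech (β * g * Real.sqrt (qOverlap β h) + h) ^ 4 ∂stdGaussian ≤ 1 - g0

/-- The one-dimensional RGD/AMP update map `f_{β,λ}`. -/
def fbl (β lam z : ℝ) : ℝ :=
  ∫ g, Real.tanh (β * g * Real.sqrt (qOverlap β (β * lam * z)) + β * lam * z) ∂stdGaussian

/-- `h_* = inf{h ≥ 0 : (β,h) satisfies AT}`. -/
def hStar (β : ℝ) : ℝ := sInf {h : ℝ | 0 ≤ h ∧ ATCond β h}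


open Real in
lemma aux_hasDeriv (x : ℝ) : HasDerivAt Real.tanh (1 - Real.tanh x ^ 2) x := by
  have h := (Real.hasDerivAt_sinh x).div (Real.hasDerivAt_cosh x) (Real.cosh_pos x).ne'
  have e : Real.tanh = fun y => Real.sinh y / Real.cosh y :=
    funext Real.tanh_eq_sinh_div_cosh
  rw [e]
  refine HasDerivAt.congr_deriv h ?_
  have := (Real.cosh_pos x).ne'
  field_simp

lemma aux_cont : Continuous Real.tanh :=
  continuous_iff_continuousAt.2 fun x => (aux_hasDeriv x).continuousAt

lemma aux_psi_mono : Monotone (fun x : ℝ => x - Real.tanh x) := by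
  have hd : ∀ x : ℝ, HasDerivAt (fun x : ℝ => x - Real.tanh x) (Real.tanh x ^ 2) x := by
    intro x
    have := (hasDerivAt_id' x).sub (aux_hasDeriv x)
    exact HasDerivAt.congr_deriv this (by ring)
  apply monotone_of_deriv_nonneg (fun x => (hd x).differentiableAt)
  intro x
  rw [(hd x).deriv]
  positivity

lemma aux_tanh_mono : Monotone Real.tanh := by
  apply monotone_of_deriv_nonneg (fun x => (aux_hasDeriv x).differentiableAt)
  intro x
  rw [(aux_hasDeriv x).deriv]
  nlinarith [Real.tanh_lt_one x, Real.neg_one_lt_tanh x]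

lemma aux_le {x : ℝ} (hx : 0 ≤ x) : Real.tanh x ≤ x := by
  have := aux_psi_mono hx
  simp at this
  linarith

lemma aux_nonneg {x : ℝ} (hx : 0 ≤ x) : 0 ≤ Real.tanh x := by
  have := aux_tanh_mono hx
  simpa using this

lemma aux_sq_le (x : ℝ) : Real.tanh x ^ 2 ≤ x ^ 2 := by
  rcases le_total 0 x with h | h
  · exact pow_le_pow_left₀ (aux_nonneg h) (aux_le h) 2
  · have h' : 0 ≤ -x := by linarith
    have := pow_le_pow_left₀ (aux_nonneg h') (aux_le h') 2
    simpa using this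

lemma aux_cubic {x : ℝ} (hx : 0 ≤ x) : x - x ^ 3 / 3 ≤ Real.tanh x := by
  have hd : ∀ x : ℝ, HasDerivAt (fun x : ℝ => Real.tanh x - x + x ^ 3 / 3)
      (x ^ 2 - Real.tanh x ^ 2) x := by
    intro x
    have := ((aux_hasDeriv x).sub (hasDerivAt_id' x)).add ((hasDerivAt_pow 3 x).div_const 3)
    exact HasDerivAt.congr_deriv this (by norm_num; ring)
  have hm : Monotone (fun x : ℝ => Real.tanh x - x + x ^ 3 / 3) := by
    apply monotone_of_deriv_nonneg (fun x => (hd x).differentiableAt)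
    intro x
    rw [(hd x).deriv]
    linarith [aux_sq_le x]
  have := hm hx
  simp at this
  linarith

lemma aux_sq_ge_pos {x : ℝ} (hx : 0 ≤ x) : x ^ 2 - 2 / 3 * x ^ 4 ≤ Real.tanh x ^ 2 := by
  rcases le_total (x ^ 2) 3 with h | h
  · have h0 : 0 ≤ x - x ^ 3 / 3 := by nlinarith
    have := pow_le_pow_left₀ h0 (aux_cubic hx) 2
    nlinarith [sq_nonneg (x ^ 3)]
  · nlinarith [sq_nonneg (Real.tanh x)]

lemma aux_sq_ge (x : ℝ) : x ^ 2 - 2 / 3 * x ^ 4 ≤ Real.tanh x ^ 2 := by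
  rcases le_total 0 x with h | h
  · exact aux_sq_ge_pos h
  · have := aux_sq_ge_pos (x := -x) (by linarith)
    rw [Real.tanh_neg] at this
    linarith [this, show (-x) ^ 2 = x ^ 2 by ring, show (-x) ^ 4 = x ^ 4 by ring,
      show (-Real.tanh x) ^ 2 = Real.tanh x ^ 2 by ring]

lemma aux_tanh_one : 3 / 4 ≤ Real.tanh 1 := by
  rw [Real.tanh_eq_sinh_div_cosh, le_div_iff₀ (Real.cosh_pos 1), Real.sinh_eq, Real.cosh_eq]
  have h1 := Real.exp_one_gt_d9
  have h2 : Real.exp 1 * Real.exp (-1) = 1 := by rw [← Real.exp_add]; simp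
  have h3 := Real.exp_pos (-1)
  nlinarith

lemma aux_quad (x : ℝ) : x - x ^ 2 / 3 ≤ Real.tanh x := by
  rcases le_total 0 x with h | h
  · rcases le_total x 1 with h1 | h1
    · have := aux_cubic h
      nlinarith [mul_nonneg (sq_nonneg x) (sub_nonneg.2 h1)]
    · have := aux_tanh_mono h1
      nlinarith [aux_tanh_one, sq_nonneg (x - 3 / 2)]
  · have := aux_psi_mono h
    simp at this
    nlinarith

lemma aux_moment (n : ℕ) : ∫ g, g ^ n ∂(gaussianReal 0 1) =
    iteratedDeriv n (fun t : ℝ => Real.exp (t ^ 2 / 2)) 0 := by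
  have h := iteratedDeriv_mgf_zero (X := fun x : ℝ => x) (μ := gaussianReal 0 1) (by simp) n
  rw [mgf_fun_id_gaussianReal] at h
  simp only [zero_mul, zero_add, NNReal.coe_one, one_mul] at h
  rw [h]
  rfl

lemma aux_derivs (p p' : ℝ → ℝ) (hp : ∀ t, HasDerivAt p (p' t) t) :
    deriv (fun t : ℝ => p t * Real.exp (t ^ 2 / 2)) =
      fun t => (p' t + t * p t) * Real.exp (t ^ 2 / 2) := by
  funext t
  have h1 : HasDerivAt (fun t : ℝ => t ^ 2 / 2) t t := by
    have := (hasDerivAt_pow 2 t).div_const 2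
    exact HasDerivAt.congr_deriv this (by norm_num)
  have h2 : HasDerivAt (fun t : ℝ => p t * Real.exp (t ^ 2 / 2))
      ((p' t + t * p t) * Real.exp (t ^ 2 / 2)) t :=
    HasDerivAt.congr_deriv ((hp t).mul h1.exp) (by ring)
  exact h2.deriv

lemma aux_d1 : deriv (fun t : ℝ => Real.exp (t ^ 2 / 2)) =
    fun t => t * Real.exp (t ^ 2 / 2) := by
  have := aux_derivs (fun _ => 1) (fun _ => 0) (fun t => hasDerivAt_const t 1)
  simpa using this

lemma aux_d2 : deriv (fun t : ℝ => t * Real.exp (t ^ 2 / 2)) =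
    fun t => (1 + t ^ 2) * Real.exp (t ^ 2 / 2) := by
  rw [aux_derivs (fun t => t) (fun _ => 1) (fun t => hasDerivAt_id' t)]
  funext t; ring

lemma aux_d3 : deriv (fun t : ℝ => (1 + t ^ 2) * Real.exp (t ^ 2 / 2)) =
    fun t => (3 * t + t ^ 3) * Real.exp (t ^ 2 / 2) := by
  rw [aux_derivs (fun t => 1 + t ^ 2) (fun t => 2 * t)
    (fun t => by simpa using (hasDerivAt_pow 2 t).const_add 1)]
  funext t; ring

lemma aux_d4 : deriv (fun t : ℝ => (3 * t + t ^ 3) * Real.exp (t ^ 2 / 2)) =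
    fun t => (3 + 6 * t ^ 2 + t ^ 4) * Real.exp (t ^ 2 / 2) := by
  rw [aux_derivs (fun t => 3 * t + t ^ 3) (fun t => 3 + 3 * t ^ 2)
    (fun t => HasDerivAt.congr_deriv
      (((hasDerivAt_id' t).const_mul 3).add (hasDerivAt_pow 3 t)) (by norm_num))]
  funext t; ring

lemma aux_m1 : ∫ g, g ∂(gaussianReal 0 1) = 0 := by simp

lemma aux_m2 : ∫ g, g ^ 2 ∂(gaussianReal 0 1) = 1 := by
  rw [aux_moment]
  simp only [iteratedDeriv_succ, iteratedDeriv_zero, aux_d1, aux_d2]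
  simp

lemma aux_m3 : ∫ g, g ^ 3 ∂(gaussianReal 0 1) = 0 := by
  rw [aux_moment]
  simp only [iteratedDeriv_succ, iteratedDeriv_zero, aux_d1, aux_d2, aux_d3]
  simp

lemma aux_m4 : ∫ g, g ^ 4 ∂(gaussianReal 0 1) = 3 := by
  rw [aux_moment]
  simp only [iteratedDeriv_succ, iteratedDeriv_zero, aux_d1, aux_d2, aux_d3, aux_d4]
  simp

lemma aux_int (n : ℕ) : Integrable (fun g : ℝ => g ^ n) (gaussianReal 0 1) := by
  rcases Nat.eq_zero_or_pos n with h | h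
  · subst h; simp
  · have := (memLp_id_gaussianReal' (μ := 0) (v := 1) (n : ENNReal) (by simp)).integrable_norm_pow h.ne'
    refine this.mono' (by fun_prop) (by simp)

lemma aux_lin_int (s h : ℝ) : Integrable (fun g : ℝ => s * g + h) (gaussianReal 0 1) := by
  have := (aux_int 1).const_mul s |>.add (integrable_const h)
  simpa using this

lemma aux_lin (s h : ℝ) : ∫ g, (s * g + h) ∂(gaussianReal 0 1) = h := by
  have h1 := (aux_int 1).const_mul s
  simp only [pow_one] at h1
  rw [integral_add h1 (integrable_const h), integral_const_mul, aux_m1]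
  simp

lemma aux_sq_eq (s h : ℝ) : (fun g : ℝ => (s * g + h) ^ 2) =
    fun g => s ^ 2 * g ^ 2 + (2 * s * h * g ^ 1 + h ^ 2) := by
  funext g; ring

lemma aux_sq_int (s h : ℝ) : Integrable (fun g : ℝ => (s * g + h) ^ 2) (gaussianReal 0 1) := by
  rw [aux_sq_eq]
  exact ((aux_int 2).const_mul _).add (((aux_int 1).const_mul _).add (integrable_const _))

lemma aux_sq (s h : ℝ) : ∫ g, (s * g + h) ^ 2 ∂(gaussianReal 0 1) = s ^ 2 + h ^ 2 := by
  have i1 : Integrable (fun g : ℝ => 2 * s * h * g ^ 1 + h ^ 2) (gaussianReal 0 1) :=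
    ((aux_int 1).const_mul _).add (integrable_const _)
  rw [aux_sq_eq, integral_add ((aux_int 2).const_mul _) i1,
    integral_add ((aux_int 1).const_mul _) (integrable_const _),
    integral_const_mul, integral_const_mul, aux_m2]
  simp

lemma aux_4_eq (s h : ℝ) : (fun g : ℝ => (s * g + h) ^ 4) =
    fun g => s ^ 4 * g ^ 4 + (4 * s ^ 3 * h * g ^ 3 + (6 * s ^ 2 * h ^ 2 * g ^ 2 +
      (4 * s * h ^ 3 * g ^ 1 + h ^ 4))) := by
  funext g; ring

lemma aux_4_int (s h : ℝ) : Integrable (fun g : ℝ => (s * g + h) ^ 4) (gaussianReal 0 1) := by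
  rw [aux_4_eq]
  exact ((aux_int 4).const_mul _).add (((aux_int 3).const_mul _).add
    (((aux_int 2).const_mul _).add (((aux_int 1).const_mul _).add (integrable_const _))))

lemma aux_4 (s h : ℝ) : ∫ g, (s * g + h) ^ 4 ∂(gaussianReal 0 1) =
    3 * s ^ 4 + 6 * s ^ 2 * h ^ 2 + h ^ 4 := by
  have i1 : Integrable (fun g : ℝ => 4 * s * h ^ 3 * g ^ 1 + h ^ 4) (gaussianReal 0 1) :=
    ((aux_int 1).const_mul (4 * s * h ^ 3)).add (integrable_const (h ^ 4))
  have i2 : Integrable (fun g : ℝ => 6 * s ^ 2 * h ^ 2 * g ^ 2 +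
      (4 * s * h ^ 3 * g ^ 1 + h ^ 4)) (gaussianReal 0 1) :=
    ((aux_int 2).const_mul (6 * s ^ 2 * h ^ 2)).add i1
  have i3 : Integrable (fun g : ℝ => 4 * s ^ 3 * h * g ^ 3 + (6 * s ^ 2 * h ^ 2 * g ^ 2 +
      (4 * s * h ^ 3 * g ^ 1 + h ^ 4))) (gaussianReal 0 1) :=
    ((aux_int 3).const_mul (4 * s ^ 3 * h)).add i2
  rw [aux_4_eq, integral_add ((aux_int 4).const_mul _) i3,
    integral_add ((aux_int 3).const_mul _) i2,
    integral_add ((aux_int 2).const_mul _) i1,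
    integral_add ((aux_int 1).const_mul _) (integrable_const _),
    integral_const_mul, integral_const_mul, integral_const_mul, integral_const_mul,
    aux_m2, aux_m3, aux_m4]
  simp
  ring

lemma aux_tanh_norm (x : ℝ) : ‖Real.tanh x‖ ≤ 1 := by
  rw [Real.norm_eq_abs, abs_le]
  exact ⟨(Real.neg_one_lt_tanh x).le, (Real.tanh_lt_one x).le⟩

lemma aux_tanh_sq_norm (x : ℝ) : ‖Real.tanh x ^ 2‖ ≤ 1 := by
  rw [norm_pow]
  exact pow_le_one₀ (norm_nonneg _) (aux_tanh_norm x)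

lemma aux_tanh_int (s h : ℝ) :
    Integrable (fun g : ℝ => Real.tanh (s * g + h)) (gaussianReal 0 1) :=
  (integrable_const (1 : ℝ)).mono'
    (aux_cont.comp (by fun_prop : Continuous fun g : ℝ => s * g + h)).aestronglyMeasurable
    (ae_of_all _ fun _ => aux_tanh_norm _)

lemma aux_tanh_sq_int (s h : ℝ) :
    Integrable (fun g : ℝ => Real.tanh (s * g + h) ^ 2) (gaussianReal 0 1) :=
  (integrable_const (1 : ℝ)).mono'
    ((aux_cont.comp (by fun_prop : Continuous fun g : ℝ => s * g + h)).pow 2).aestronglyMeasurable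
    (ae_of_all _ fun _ => aux_tanh_sq_norm _)

lemma aux_F_le (s h : ℝ) :
    ∫ g, Real.tanh (s * g + h) ^ 2 ∂(gaussianReal 0 1) ≤ s ^ 2 + h ^ 2 := by
  rw [← aux_sq]
  exact integral_mono (aux_tanh_sq_int s h) (aux_sq_int s h) fun g => aux_sq_le _

lemma aux_F_ge (s h : ℝ) :
    s ^ 2 + h ^ 2 - 2 / 3 * (3 * s ^ 4 + 6 * s ^ 2 * h ^ 2 + h ^ 4) ≤
      ∫ g, Real.tanh (s * g + h) ^ 2 ∂(gaussianReal 0 1) := by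
  rw [← aux_sq, ← aux_4, ← integral_const_mul,
    ← integral_sub (aux_sq_int s h) ((aux_4_int s h).const_mul _)]
  exact integral_mono ((aux_sq_int s h).sub ((aux_4_int s h).const_mul _))
    (aux_tanh_sq_int s h) fun g => aux_sq_ge _

lemma aux_T_ge (s h : ℝ) :
    h - (s ^ 2 + h ^ 2) / 3 ≤ ∫ g, Real.tanh (s * g + h) ∂(gaussianReal 0 1) := by
  rw [← aux_sq, ← integral_div]
  nth_rewrite 1 [← aux_lin s h]
  rw [← integral_sub (aux_lin_int s h) ((aux_sq_int s h).div_const _)]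
  exact integral_mono ((aux_lin_int s h).sub ((aux_sq_int s h).div_const _))
    (aux_tanh_int s h) fun g => aux_quad _

lemma aux_T_symm (s h : ℝ) : ∫ g, Real.tanh (s * g + h) ∂(gaussianReal 0 1) =
    ∫ g, Real.tanh (-s * g + h) ∂(gaussianReal 0 1) := by
  have hm := gaussianReal_map_neg (μ := 0) (v := 1)
  rw [neg_zero] at hm
  nth_rewrite 1 [← hm]
  have hc : Continuous fun g : ℝ => Real.tanh (s * g + h) :=
    aux_cont.comp (by fun_prop : Continuous fun g : ℝ => s * g + h)
  rw [integral_map (by fun_prop) hc.aestronglyMeasurable]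
  simp

lemma aux_T_le (s h : ℝ) (hh : 0 ≤ h) :
    ∫ g, Real.tanh (s * g + h) ∂(gaussianReal 0 1) ≤ h := by
  have h1 : ∫ g, (Real.tanh (s * g + h) + Real.tanh (-s * g + h)) ∂(gaussianReal 0 1) ≤
      ∫ _g : ℝ, 2 * h ∂(gaussianReal 0 1) := by
    refine integral_mono ((aux_tanh_int s h).add (aux_tanh_int (-s) h)) (integrable_const _) ?_
    intro g
    have := aux_psi_mono (show s * g - h ≤ s * g + h by linarith)
    simp only at this
    have e : Real.tanh (s * g - h) = - Real.tanh (-s * g + h) := by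
      rw [← Real.tanh_neg]; congr 1; ring
    rw [e] at this
    simp only
    linarith
  rw [integral_add (aux_tanh_int s h) (aux_tanh_int (-s) h), ← aux_T_symm] at h1
  simp at h1
  linarith

lemma aux_F_cont (β h : ℝ) : Continuous fun q : ℝ =>
    ∫ g, Real.tanh (β * g * Real.sqrt q + h) ^ 2 ∂(gaussianReal 0 1) := by
  refine continuous_of_dominated (bound := fun _ => 1) ?_ ?_ (integrable_const _) ?_
  · intro q
    exact ((aux_cont.comp
      (by fun_prop : Continuous fun g : ℝ => β * g * Real.sqrt q + h)).pow 2).aestronglyMeasurable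
  · exact fun q => ae_of_all _ fun g => aux_tanh_sq_norm _
  · exact ae_of_all _ fun g => (aux_cont.comp
      (by fun_prop : Continuous fun q : ℝ => β * g * Real.sqrt q + h)).pow 2

lemma aux_mem (β h : ℝ) (hh : 0 < h) : 0 ≤ qOverlap β h ∧
    qOverlap β h = ∫ g, Real.tanh (β * g * Real.sqrt (qOverlap β h) + h) ^ 2
      ∂(gaussianReal 0 1) := by
  set F : ℝ → ℝ := fun q : ℝ =>
    ∫ g, Real.tanh (β * g * Real.sqrt q + h) ^ 2 ∂(gaussianReal 0 1) with hF
  have hFc : Continuous F := aux_F_cont β h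
  have hF0 : F 0 = Real.tanh h ^ 2 := by simp [hF]
  have hpos : 0 < F 0 := by
    rw [hF0]
    have : Real.tanh h ≠ 0 := by
      rw [Real.tanh_eq_sinh_div_cosh]
      exact (div_pos (Real.sinh_pos_iff.2 hh) (Real.cosh_pos h)).ne'
    positivity
  have hF1 : F 1 ≤ 1 := by
    have := norm_integral_le_of_norm_le_const (μ := gaussianReal 0 1) (C := 1)
      (ae_of_all _ fun g : ℝ => aux_tanh_sq_norm (β * g * Real.sqrt 1 + h))
    have h2 := le_trans (le_abs_self _) this
    simpa [hF] using h2
  have hset : {q : ℝ | q ∈ Set.Ioc (0 : ℝ) 1 ∧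
      q = ∫ g, Real.tanh (β * g * Real.sqrt q + h) ^ 2 ∂(gaussianReal 0 1)} =
      Set.Icc 0 1 ∩ {q | q = F q} := by
    ext q
    simp only [Set.mem_ofPred_eq, Set.mem_inter_iff, Set.mem_Ioc, Set.mem_Icc]
    constructor
    · rintro ⟨⟨a, b⟩, c⟩
      exact ⟨⟨a.le, b⟩, c⟩
    · rintro ⟨⟨a, b⟩, c⟩
      refine ⟨⟨lt_of_le_of_ne a ?_, b⟩, c⟩
      intro h0
      rw [← h0] at c
      linarith
  have hcomp : IsCompact (Set.Icc (0 : ℝ) 1 ∩ {q | q = F q}) :=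
    isCompact_Icc.inter_right (isClosed_eq continuous_id hFc)
  have hne : (Set.Icc (0 : ℝ) 1 ∩ {q | q = F q}).Nonempty := by
    have hc : ContinuousOn (fun q => q - F q) (Set.Icc 0 1) :=
      (continuous_id.sub hFc).continuousOn
    obtain ⟨q, hq, hq'⟩ := intermediate_value_Icc zero_le_one hc
      (show (0 : ℝ) ∈ Set.Icc _ _ from ⟨by linarith, by linarith⟩)
    exact ⟨q, hq, by simp only [Set.mem_ofPred_eq]; simp only at hq'; linarith⟩
  have hmem := hcomp.sSup_mem hne
  rw [← hset] at hmem
  have hq : qOverlap β h = sSup {q : ℝ | q ∈ Set.Ioc (0 : ℝ) 1 ∧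
      q = ∫ g, Real.tanh (β * g * Real.sqrt q + h) ^ 2 ∂(gaussianReal 0 1)} := by
    unfold qOverlap
    rw [if_neg hh.ne']
    rfl
  rw [← hq] at hmem
  exact ⟨hmem.1.1.le, hmem.2⟩

/-- For `0 ≤ β < 1` and `h ≥ 0`, the overlap constant `q = q_{β,h}` and
`q₁ = q₁(β,h)` satisfy `h²/(1−β²) − 2h⁴/(1−β²)³ ≤ q ≤ h²/(1−β²)` and
`h − h²/(3(1−β²)) ≤ q₁ ≤ h`. -/
theorem stmt14 (β h : ℝ) (hβ0 : 0 ≤ β) (hβ1 : β < 1) (hh : 0 ≤ h) :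
    h ^ 2 / (1 - β ^ 2) - 2 * h ^ 4 / (1 - β ^ 2) ^ 3 ≤ qOverlap β h ∧
    qOverlap β h ≤ h ^ 2 / (1 - β ^ 2) ∧
    h - h ^ 2 / (3 * (1 - β ^ 2)) ≤ q1 β h ∧
    q1 β h ≤ h := by
  have ha : 0 < 1 - β ^ 2 := by nlinarith
  rcases hh.eq_or_lt with h0 | hpos
  · subst h0
    have hq : qOverlap β 0 = 0 := by simp [qOverlap]
    have hq1 : q1 β 0 = 0 := by simp [q1, hq]
    simp [hq, hq1]
  obtain ⟨hq0, hq⟩ := aux_mem β h hpos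
  set q := qOverlap β h with hqdef
  set s := β * Real.sqrt q with hs
  have hs2 : s ^ 2 = β ^ 2 * q := by rw [hs, mul_pow, Real.sq_sqrt hq0]
  have e : ∀ g : ℝ, β * g * Real.sqrt q + h = s * g + h := fun g => by rw [hs]; ring
  have hq1 : q1 β h = ∫ g, Real.tanh (s * g + h) ∂(gaussianReal 0 1) := by
    simp only [← e]
    rfl
  simp only [e] at hq
  have hle := aux_F_le s h
  have hge := aux_F_ge s h
  rw [← hq] at hle hge
  have hs4 : s ^ 4 = (β ^ 2 * q) ^ 2 := by rw [← hs2]; ring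
  rw [hs2] at hle
  rw [hs4, hs2] at hge
  have hup : q ≤ h ^ 2 / (1 - β ^ 2) := by
    rw [le_div_iff₀ ha]; linarith
  refine ⟨?_, hup, ?_, ?_⟩
  · generalize hA : 1 - β ^ 2 = a at *
    have hb : β ^ 2 = 1 - a := by linarith
    have hb0 : 0 ≤ 1 - a := by rw [← hb]; positivity
    rw [hb] at hge
    obtain ⟨m, hm⟩ : ∃ m, m = h ^ 2 / a := ⟨_, rfl⟩
    have hh2 : h ^ 2 = m * a := by rw [hm]; field_simp
    have hm0 : 0 ≤ m := by rw [hm]; positivity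
    rw [← hm] at hup
    have hh4 : h ^ 4 = (m * a) ^ 2 := by rw [← hh2]; ring
    rw [hh4, hh2] at hge
    have k1 : (1 - a) * q ≤ (1 - a) * m := mul_le_mul_of_nonneg_left hup hb0
    have k2 : ((1 - a) * q) ^ 2 ≤ ((1 - a) * m) ^ 2 :=
      pow_le_pow_left₀ (mul_nonneg hb0 hq0) k1 2
    have k3 : (1 - a) * q * (m * a) ≤ (1 - a) * m * (m * a) :=
      mul_le_mul_of_nonneg_right k1 (by positivity)
    have k4 : m * a - 2 * m ^ 2 ≤ a * q := by
      nlinarith [sq_nonneg (m * a)]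
    have k5 : h ^ 2 / a - 2 * h ^ 4 / a ^ 3 = (m * a - 2 * m ^ 2) / a := by
      rw [hh4, hh2]; field_simp
    rw [k5, div_le_iff₀ ha]
    linarith
  · rw [hq1]
    refine le_trans ?_ (aux_T_ge s h)
    rw [hs2]
    have : h ^ 2 / (3 * (1 - β ^ 2)) = (h ^ 2 / (1 - β ^ 2)) / 3 := by
      field_simp
    rw [this]
    have h2 : h ^ 2 = (h ^ 2 / (1 - β ^ 2)) * (1 - β ^ 2) := by field_simp
    have h3 : β ^ 2 * q ≤ β ^ 2 * (h ^ 2 / (1 - β ^ 2)) :=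
      mul_le_mul_of_nonneg_left hup (sq_nonneg β)
    have h4 : β ^ 2 * q + h ^ 2 ≤ h ^ 2 / (1 - β ^ 2) := by linarith
    linarith
  · rw [hq1]
    exact aux_T_le s h hh
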